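/- arXiv:2601.16588 — 2 statements merged into one kernel-verified Lean document; each statement's English description precedes it below -/
import Mathlib

section
/- Let M be a symmetric n×n integer matrix with det(M) ≠ 0 and let p be an odd prime. Let 0 ≤ k_1 ≤ k_2 ≤ … ≤ k_n be integers and q ≥ 1 an integer not divisible by p such that the cokernel ℤⁿ/Mℤⁿ is isomorphic to ℤ/p^{k_1} ⊕ ℤ/p^{k_2} ⊕ … ⊕ ℤ/p^{k_n} ⊕ ℤ/q. Then there exists an n×n integer matrix T with det T = ±1 such that: the (i,j)-entry of the rational matrix (T·M·Tᵀ)^{−1} has ord_p ≥ 0 for i ≠ j and ord_p exactly equal to −k_i for i = j; moreover, the (i,j)-entry of the integer matrix T·M·Tᵀ has ord_p ≥ k_i + k_j for i ≠ j and ord_p ≥ k_i for i = j. -/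
open Matrix

/-- The `p`-adic valuation on `ℚ`, with `ordp p 0 = ⊤`. -/
noncomputable def ordp (p : ℕ) (z : ℚ) : WithTop ℤ :=
  if z = 0 then ⊤ else (padicValRat p z : WithTop ℤ)

/-- unimodular congruence -/
def UCong {n : ℕ} (A B : Matrix (Fin n) (Fin n) ℤ) : Prop :=
  ∃ T : Matrix (Fin n) (Fin n) ℤ, (T.det = 1 ∨ T.det = -1) ∧ B = T * A * Tᵀ

lemma UCong.refl {n : ℕ} (A : Matrix (Fin n) (Fin n) ℤ) : UCong A A :=
  ⟨1, by simp, by simp⟩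

lemma UCong.trans {n : ℕ} {A B C : Matrix (Fin n) (Fin n) ℤ} (h : UCong A B) (h' : UCong B C) :
    UCong A C := by
  obtain ⟨T, hT, rfl⟩ := h
  obtain ⟨S, hS, rfl⟩ := h'
  refine ⟨S * T, ?_, by simp [Matrix.mul_assoc, Matrix.transpose_mul]⟩
  rw [Matrix.det_mul]
  rcases hT with h | h <;> rcases hS with h' | h' <;> simp [h, h']

lemma UCong.symmetric {n : ℕ} {A B : Matrix (Fin n) (Fin n) ℤ} (h : UCong A B) (hA : A.IsSymm) :
    B.IsSymm := by
  obtain ⟨T, hT, rfl⟩ := h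
  unfold Matrix.IsSymm at *
  simp [Matrix.transpose_mul, hA, Matrix.mul_assoc]

lemma UCong.perm {n : ℕ} (A : Matrix (Fin n) (Fin n) ℤ) (σ : Equiv.Perm (Fin n)) :
    UCong A (A.submatrix σ σ) := by
  refine ⟨σ.permMatrix ℤ, ?_, ?_⟩
  · rw [Matrix.det_permutation]
    rcases Int.units_eq_one_or (Equiv.Perm.sign σ) with h | h <;> simp [h]
  · rw [PEquiv.toMatrix_toPEquiv_mul]
    ext i j
    simp [Matrix.mul_apply, PEquiv.toMatrix_apply, Equiv.toPEquiv_apply, Equiv.symm_apply_eq]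

lemma UCong.transv {n : ℕ} (A : Matrix (Fin n) (Fin n) ℤ) (i : Fin n) (c : Fin n → ℤ)
    (hc : c i = 0) :
    UCong A (Matrix.of fun l m => A l m - c l * A i m - c m * A l i + c l * c m * A i i) := by
  refine ⟨1 + replicateCol Unit (-c) * replicateRow Unit (Pi.single i (1:ℤ)), ?_, ?_⟩
  · left
    rw [Matrix.det_one_add_replicateCol_mul_replicateRow]
    simp [hc]
  · have h : ∀ l m, (1 + replicateCol Unit (-c) * replicateRow Unit (Pi.single i (1:ℤ)) :
        Matrix (Fin n) (Fin n) ℤ) l m = (if l = m then 1 else 0) - c l * (if m = i then 1 else 0) := by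
      intro l m
      simp [Matrix.add_apply, Matrix.one_apply, Matrix.mul_apply, Pi.single_apply, sub_eq_add_neg]
      split_ifs <;> simp
    ext l m
    simp only [Matrix.mul_apply, Matrix.transpose_apply, h]
    simp [sub_mul, mul_sub, Finset.sum_sub_distrib]
    ring

lemma exists_elim {p : ℕ} (hp : p.Prime) (N : ℕ) (m : ℕ) (a b : ℤ)
    (ha : (p : ℤ) ^ m ∣ a) (ha' : ¬ (p : ℤ) ^ (m + 1) ∣ a) (hb : (p : ℤ) ^ m ∣ b) :
    ∃ c : ℤ, (p : ℤ) ^ N ∣ b - c * a := by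
  obtain ⟨a, rfl⟩ := ha
  obtain ⟨b, rfl⟩ := hb
  have hpa : ¬ (p : ℤ) ∣ a := fun h => ha' (by rw [pow_succ]; exact mul_dvd_mul_left _ h)
  have hco : IsCoprime a ((p : ℤ) ^ N) :=
    (((Nat.prime_iff_prime_int.mp hp).coprime_iff_not_dvd.mpr hpa).symm).pow_right
  obtain ⟨x, y, hxy⟩ := hco
  refine ⟨b * x, ⟨p ^ m * b * y, ?_⟩⟩
  linear_combination (-(p:ℤ)^m * b) * hxy

lemma diag_step {n : ℕ} {p : ℕ} (hp : p.Prime) (hp2 : p ≠ 2) (N : ℕ)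
    (A : Matrix (Fin n) (Fin n) ℤ) (hA : A.IsSymm) (S : Finset (Fin n)) (hS : S ≠ Finset.univ)
    (h : ∀ s ∈ S, ∀ j, j ≠ s → (p : ℤ) ^ N ∣ A s j) :
    ∃ (B : Matrix (Fin n) (Fin n) ℤ) (S' : Finset (Fin n)), UCong A B ∧ S.card < S'.card ∧
      ∀ s ∈ S', ∀ j, j ≠ s → (p : ℤ) ^ N ∣ B s j := by
  have hpp := Nat.prime_iff_prime_int.mp hp
  have hsym : ∀ i j, A i j = A j i := fun i j => hA.apply j i
  by_cases hall : ∀ i ∉ S, ∀ j ∉ S, (p : ℤ) ^ N ∣ A i j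
  · refine ⟨A, Finset.univ, UCong.refl A, ?_, ?_⟩
    · exact Finset.card_lt_card (Finset.ssubset_univ_iff.mpr hS)
    · intro s _ j hj
      by_cases hs : s ∈ S
      · exact h s hs j hj
      by_cases hj' : j ∈ S
      · rw [hsym]; exact h j hj' s hj.symm
      · exact hall s hs j hj'
  have hex : ∃ m : ℕ, ∃ i ∉ S, ∃ j ∉ S, ¬ (p : ℤ) ^ (m + 1) ∣ A i j := by
    push Not at hall
    obtain ⟨i, hi, j, hj, hij⟩ := hall
    refine ⟨N, i, hi, j, hj, fun hd => hij ((pow_dvd_pow _ (Nat.le_succ N)).trans hd)⟩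
  classical
  obtain ⟨m, hm, hmin⟩ : ∃ m : ℕ, (∃ i ∉ S, ∃ j ∉ S, ¬ (p : ℤ) ^ (m + 1) ∣ A i j) ∧
      ∀ i ∉ S, ∀ j ∉ S, (p : ℤ) ^ m ∣ A i j := by
    refine ⟨Nat.find hex, Nat.find_spec hex, ?_⟩
    intro i hi j hj
    rcases hfm : Nat.find hex with _ | m
    · simp
    · by_contra hcon
      exact Nat.find_min hex (m := m) (by omega) ⟨i, hi, j, hj, hcon⟩
  have key : ∃ B : Matrix (Fin n) (Fin n) ℤ, UCong A B ∧
      (∀ s ∈ S, ∀ j, j ≠ s → (p : ℤ) ^ N ∣ B s j) ∧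
      (∀ i ∉ S, ∀ j ∉ S, (p : ℤ) ^ m ∣ B i j) ∧ ∃ i ∉ S, ¬ (p : ℤ) ^ (m + 1) ∣ B i i := by
    by_cases hd : ∃ i ∉ S, ¬ (p : ℤ) ^ (m + 1) ∣ A i i
    · exact ⟨A, UCong.refl A, h, hmin, hd⟩
    push Not at hd
    obtain ⟨i, hi, j, hj, hij⟩ := hm
    have hne : i ≠ j := by rintro rfl; exact hij (hd i hi)
    refine ⟨_, UCong.transv A j (Pi.single i (-1)) (by simp [hne.symm]), ?_, ?_, i, hi, ?_⟩
    · intro s hs l hl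
      have hsi : s ≠ i := by rintro rfl; exact hi hs
      have hsj : j ≠ s := by rintro rfl; exact hj hs
      simp only [Matrix.of_apply, Pi.single_apply, hsi, if_false, zero_mul, sub_zero, add_zero]
      exact dvd_sub (h s hs l hl) (Dvd.dvd.mul_left (h s hs j hsj) _)
    · intro a ha b hb
      refine dvd_add (dvd_sub (dvd_sub (hmin a ha b hb) ?_) ?_) ?_
      · exact Dvd.dvd.mul_left (hmin j hj b hb) _
      · exact Dvd.dvd.mul_left (hmin a ha j hj) _
      · exact Dvd.dvd.mul_left (hmin j hj j hj) _
    · simp only [Matrix.of_apply, Pi.single_eq_same]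
      intro hcon
      have h2 : (p : ℤ) ^ (m + 1) ∣ 2 * A i j := by
        have := dvd_sub (dvd_sub hcon (hd i hi)) (hd j hj)
        rw [hsym j i] at this
        have e : 2 * A i j = A i i - -1 * A i j - -1 * A i j + -1 * -1 * A j j - A i i - A j j := by
          ring
        rw [e]
        exact this
      have hco : IsCoprime ((p : ℤ) ^ (m + 1)) 2 := by
        apply IsCoprime.pow_left
        rw [hpp.coprime_iff_not_dvd]
        intro hdv
        exact hp2 ((Nat.prime_dvd_prime_iff_eq hp Nat.prime_two).mp (by exact_mod_cast hdv))
      exact hij (hco.dvd_of_dvd_mul_left h2)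
  obtain ⟨B, hAB, hBS, hBm, i, hi, hBi⟩ := key
  have hBsym : ∀ i j, B i j = B j i := fun i j => (hAB.symmetric hA).apply j i
  have hc : ∃ c : Fin n → ℤ, c i = 0 ∧ (∀ s ∈ S, c s = 0) ∧
      ∀ l ∉ S, l ≠ i → (p : ℤ) ^ N ∣ B i l - c l * B i i := by
    choose! c hc using fun l (hl : l ∉ S) =>
      exists_elim hp N m (B i i) (B i l) (hBm i hi i hi) hBi (hBm i hi l hl)
    refine ⟨fun l => if l = i ∨ l ∈ S then 0 else c l, by simp, ?_, ?_⟩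
    · intro s hs; simp [hs]
    · intro l hl hli
      simpa [hl, hli] using hc l hl
  obtain ⟨c, hci, hcS, hc⟩ := hc
  refine ⟨_, insert i S, hAB.trans (UCong.transv B i c hci), ?_, ?_⟩
  · rw [Finset.card_insert_of_notMem hi]; omega
  · intro s hs j hj
    rw [Finset.mem_insert] at hs
    simp only [Matrix.of_apply]
    rcases hs with rfl | hs
    · simp only [hci, zero_mul, sub_zero, add_zero]
      by_cases hjS : j ∈ S
      · rw [hcS j hjS, zero_mul, sub_zero, hBsym]
        exact hBS j hjS s hj.symm
      · exact hc j hjS hj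
    · have hsi : i ≠ s := by rintro rfl; exact hi hs
      simp only [hcS s hs, zero_mul, sub_zero, add_zero]
      exact dvd_sub (hBS s hs j hj) (Dvd.dvd.mul_left (hBS s hs i hsi) _)

lemma diag_exists {n : ℕ} {p : ℕ} (hp : p.Prime) (hp2 : p ≠ 2) (N : ℕ)
    (A : Matrix (Fin n) (Fin n) ℤ) (hA : A.IsSymm) :
    ∃ B : Matrix (Fin n) (Fin n) ℤ, UCong A B ∧ ∀ i j, i ≠ j → (p : ℤ) ^ N ∣ B i j := by
  have main : ∀ d : ℕ, ∀ (A : Matrix (Fin n) (Fin n) ℤ) (S : Finset (Fin n)), A.IsSymm →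
      n - S.card ≤ d → (∀ s ∈ S, ∀ j, j ≠ s → (p : ℤ) ^ N ∣ A s j) →
      ∃ B : Matrix (Fin n) (Fin n) ℤ, UCong A B ∧ ∀ i j, i ≠ j → (p : ℤ) ^ N ∣ B i j := by
    intro d
    induction d with
    | zero =>
      intro A S _ hd h
      have hS : S = Finset.univ := by
        rw [← Finset.card_eq_iff_eq_univ]
        have := Finset.card_le_univ S
        simp at this ⊢
        omega
      exact ⟨A, UCong.refl A, fun i j hij => h i (by simp [hS]) j hij.symm⟩
    | succ d ih =>
      intro A S hA hd h
      by_cases hS : S = Finset.univ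
      · exact ⟨A, UCong.refl A, fun i j hij => h i (by simp [hS]) j hij.symm⟩
      · obtain ⟨B, S', hAB, hcard, hB⟩ := diag_step hp hp2 N A hA S hS h
        obtain ⟨C, hBC, hC⟩ := ih B S' (hAB.symmetric hA) (by omega) hB
        exact ⟨C, hAB.trans hBC, hC⟩
  exact main n A ∅ hA (by simp) (by simp)

lemma card_hom_coker {n : ℕ} (M : Matrix (Fin n) (Fin n) ℤ) (R : Type) [CommRing R] :
    Nat.card (((Fin n → ℤ) ⧸ LinearMap.range (Matrix.mulVecLin M)) →ₗ[ℤ] R) =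
      Nat.card {x : Fin n → R // x ᵥ* (M.map (Int.cast : ℤ → R)) = 0} := by
  have hcomp : ∀ (x : Fin n → R) (v : Fin n → ℤ),
      Fintype.linearCombination ℤ x (M *ᵥ v) =
        ∑ j, (v j : R) * (x ᵥ* (M.map (Int.cast : ℤ → R))) j := by
    intro x v
    simp only [Fintype.linearCombination_apply, Matrix.mulVec, Matrix.vecMul, dotProduct,
      Matrix.map_apply, zsmul_eq_mul, Int.cast_sum, Int.cast_mul, Finset.mul_sum, Finset.sum_mul]
    rw [Finset.sum_comm]
    refine Finset.sum_congr rfl fun j _ => Finset.sum_congr rfl fun i _ => ?_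
    ring
  have hf : ∀ f : ((Fin n → ℤ) ⧸ LinearMap.range (Matrix.mulVecLin M)) →ₗ[ℤ] R,
      Fintype.linearCombination ℤ (fun i => f (Submodule.Quotient.mk (Pi.single i 1))) =
        f ∘ₗ Submodule.mkQ _ := by
    intro f
    refine LinearMap.pi_ext' fun i => ?_
    ext
    simp
  symm
  refine Nat.card_congr
    { toFun := fun x => Submodule.liftQ _ (Fintype.linearCombination ℤ x.1) ?_
      invFun := fun f => ⟨fun i => f (Submodule.Quotient.mk (Pi.single i 1)), ?_⟩
      left_inv := ?_
      right_inv := ?_ }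
  · rintro _ ⟨v, rfl⟩
    rw [LinearMap.mem_ker, Matrix.mulVecLin_apply, hcomp, x.2]
    simp
  · ext j
    have h1 := hcomp (fun i => f (Submodule.Quotient.mk (Pi.single i 1))) (Pi.single j 1)
    rw [hf] at h1
    have h2 : (Submodule.mkQ (LinearMap.range (Matrix.mulVecLin M))) (M *ᵥ Pi.single j 1) = 0 := by
      rw [Submodule.mkQ_apply, Submodule.Quotient.mk_eq_zero]
      exact ⟨Pi.single j 1, rfl⟩
    rw [LinearMap.comp_apply, h2, map_zero] at h1
    rw [Finset.sum_eq_single j] at h1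
    · simpa using h1.symm
    · intro b _ hb
      simp [hb]
    · simp
  · rintro ⟨x, hx⟩
    ext i
    simp [Fintype.linearCombination_apply, Pi.single_apply]
  · intro f
    apply Submodule.linearMap_qext
    simp only [Submodule.liftQ_mkQ]
    exact hf f

lemma card_ker_congr {n : ℕ} {M A : Matrix (Fin n) (Fin n) ℤ} (h : UCong M A)
    (R : Type) [CommRing R] :
    Nat.card {x : Fin n → R // x ᵥ* (M.map (Int.cast : ℤ → R)) = 0} =
      Nat.card {x : Fin n → R // x ᵥ* (A.map (Int.cast : ℤ → R)) = 0} := by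
  obtain ⟨T, hT, rfl⟩ := h
  set T' : Matrix (Fin n) (Fin n) R := (Int.castRingHom R).mapMatrix T with hT'
  have hmap : ((T * M * Tᵀ).map (Int.cast : ℤ → R)) = T' * M.map (Int.cast : ℤ → R) * T'ᵀ := by
    have := map_mul (Int.castRingHom R).mapMatrix (T * M) Tᵀ
    rw [map_mul (Int.castRingHom R).mapMatrix T M] at this
    exact this
  have hu : IsUnit T'.det := by
    rw [hT', ← RingHom.map_det]
    rcases hT with h | h <;> simp [h]
  have hut : IsUnit T'ᵀ.det := by rwa [Matrix.det_transpose]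
  rw [hmap]
  symm
  refine Nat.card_congr
    { toFun := fun y => ⟨y.1 ᵥ* T', ?_⟩
      invFun := fun x => ⟨x.1 ᵥ* T'⁻¹, ?_⟩
      left_inv := ?_
      right_inv := ?_ }
  · have h := y.2
    have h2 := congrArg (fun z => z ᵥ* (T'ᵀ)⁻¹) h
    simp only [Matrix.vecMul_vecMul, Matrix.zero_vecMul] at h2
    rw [Matrix.mul_nonsing_inv_cancel_right _ _ hut] at h2
    rw [Matrix.vecMul_vecMul]
    exact h2
  · rw [Matrix.vecMul_vecMul, Matrix.mul_assoc T', Matrix.nonsing_inv_mul_cancel_left _ _ hu,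
      ← Matrix.vecMul_vecMul, x.2, Matrix.zero_vecMul]
  · rintro ⟨y, hy⟩
    simp [Matrix.vecMul_vecMul, Matrix.mul_nonsing_inv _ hu]
  · rintro ⟨y, hy⟩
    simp [Matrix.vecMul_vecMul, Matrix.nonsing_inv_mul _ hu]

lemma card_ker_diag {n : ℕ} (R : Type) [CommRing R] (A : Matrix (Fin n) (Fin n) ℤ)
    (hA : ∀ i j, i ≠ j → ((A i j : ℤ) : R) = 0) :
    Nat.card {x : Fin n → R // x ᵥ* (A.map (Int.cast : ℤ → R)) = 0} =
      ∏ i, Nat.card {x : R // ((A i i : ℤ) : R) * x = 0} := by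
  have hd : A.map (Int.cast : ℤ → R) = Matrix.diagonal fun i => ((A i i : ℤ) : R) := by
    ext i j
    by_cases h : i = j
    · subst h; simp
    · simp [h, hA i j h]
  rw [hd, ← Nat.card_pi]
  refine Nat.card_congr (Equiv.trans (Equiv.subtypeEquivRight fun x => ?_)
    (Equiv.subtypePiEquivPi (p := fun i (x : R) => ((A i i : ℤ) : R) * x = 0)))
  rw [funext_iff]
  simp [Matrix.vecMul_diagonal, mul_comm]

lemma card_hom_zmod (m : ℕ) (R : Type) [CommRing R] :
    Nat.card (ZMod m →ₗ[ℤ] R) = Nat.card {x : R // (m : R) * x = 0} := by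
  refine Nat.card_congr ((addMonoidHomLequivInt ℤ (A := ZMod m) (B := R)).symm.toEquiv.trans
    ((ZMod.lift m).symm.trans ?_))
  refine Equiv.subtypeEquiv (zmultiplesHom R).symm fun f => ?_
  have : f (m : ℤ) = (m : R) * f 1 := by
    have := f.map_zsmul (m : ℤ) 1
    simpa only [smul_eq_mul, mul_one, zsmul_eq_mul, Int.cast_natCast] using this
  simp [this]

lemma card_hom_target {n : ℕ} (k : Fin n → ℕ) (q : ℕ) (R : Type) [CommRing R] :
    Nat.card (((∀ i : Fin n, ZMod (k i)) × ZMod q) →ₗ[ℤ] R) =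
      (∏ i, Nat.card {x : R // (k i : R) * x = 0}) * Nat.card {x : R // (q : R) * x = 0} := by
  rw [← Nat.card_congr (LinearMap.coprodEquiv ℤ (R := ℤ) (M := ∀ i : Fin n, ZMod (k i))
    (M₂ := ZMod q) (M₃ := R)).toEquiv, Nat.card_prod, card_hom_zmod,
    ← Nat.card_congr (LinearMap.lsum ℤ (fun i : Fin n => ZMod (k i)) ℤ (M := R)).toEquiv,
    Nat.card_pi]
  simp_rw [card_hom_zmod]

lemma card_ann (m : ℕ) [NeZero m] (d : ℕ) :
    Nat.card {x : ZMod m // (d : ZMod m) * x = 0} = m.gcd d := by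
  have := IsAddCyclic.card_nsmulAddMonoidHom_ker (ZMod m) d
  rw [Nat.card_zmod] at this
  rw [← this]
  refine Nat.card_congr (Equiv.subtypeEquivRight fun x => ?_)
  simp [AddMonoidHom.mem_ker]

lemma card_ann_int (m : ℕ) [NeZero m] (d : ℤ) :
    Nat.card {x : ZMod m // (d : ZMod m) * x = 0} = m.gcd d.natAbs := by
  rw [← card_ann]
  refine Nat.card_congr (Equiv.subtypeEquivRight fun x => ?_)
  rcases Int.natAbs_eq d with h | h
  · conv_lhs => rw [h]
    simp
  · conv_lhs => rw [h]
    simp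

lemma gcd_prod_eq {n : ℕ} (M A : Matrix (Fin n) (Fin n) ℤ) (hMA : UCong M A)
    (p : ℕ) (hp : p.Prime) (k : Fin n → ℕ) (q : ℕ) (hpq : ¬ p ∣ q)
    (hcoker : Nonempty (((Fin n → ℤ) ⧸ LinearMap.range (Matrix.mulVecLin M)) ≃+
      ((∀ i : Fin n, ZMod (p ^ k i)) × ZMod q))) (N : ℕ)
    (hA : ∀ i j, i ≠ j → (p : ℤ) ^ N ∣ A i j) (j : ℕ) (hj : j ≤ N) :
    ∏ i, (p ^ j).gcd (A i i).natAbs = ∏ i, (p ^ j).gcd (p ^ k i) := by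
  obtain ⟨e⟩ := hcoker
  have : NeZero (p ^ j) := ⟨pow_ne_zero _ hp.ne_zero⟩
  have h1 := card_hom_coker M (ZMod (p ^ j))
  rw [card_ker_congr hMA, card_ker_diag _ A,
    Nat.card_congr (e.toIntLinearEquiv.congrLeft (ZMod (p ^ j)) ℤ).toEquiv,
    card_hom_target (fun i => p ^ k i) q] at h1
  · simp_rw [card_ann_int, card_ann] at h1
    have : (p ^ j).gcd q = 1 := Nat.Coprime.pow_left _ ((Nat.Prime.coprime_iff_not_dvd hp).mpr hpq)
    rw [this, mul_one] at h1
    exact h1.symm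
  · intro a b hab
    rw [ZMod.intCast_zmod_eq_zero_iff_dvd]
    push_cast
    exact (pow_dvd_pow _ hj).trans (hA a b hab)

lemma gcd_pow_succ {p : ℕ} (hp : p.Prime) (a j : ℕ) :
    (p ^ (j + 1)).gcd a = (p ^ j).gcd a * p ^ (if p ^ (j + 1) ∣ a then 1 else 0) := by
  split_ifs with h
  · rw [Nat.gcd_eq_left h, Nat.gcd_eq_left ((pow_dvd_pow _ (Nat.le_succ j)).trans h), pow_succ,
      pow_one]
  · rw [pow_zero, mul_one]
    apply Nat.dvd_antisymm
    · obtain ⟨i, hi, he⟩ := (Nat.dvd_prime_pow hp).mp (Nat.gcd_dvd_left (p ^ (j + 1)) a)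
      have hij : i ≠ j + 1 := by
        rintro rfl
        exact h (he ▸ Nat.gcd_dvd_right _ _)
      refine Nat.dvd_gcd ?_ (Nat.gcd_dvd_right _ _)
      rw [he]
      exact pow_dvd_pow _ (by omega)
    · exact Nat.gcd_dvd_gcd_of_dvd_left _ (pow_dvd_pow _ (Nat.le_succ j))

lemma count_eq {n : ℕ} {p : ℕ} (hp : p.Prime) (a b : Fin n → ℕ) (j : ℕ)
    (h0 : ∏ i, (p ^ j).gcd (a i) = ∏ i, (p ^ j).gcd (b i))
    (h1 : ∏ i, (p ^ (j + 1)).gcd (a i) = ∏ i, (p ^ (j + 1)).gcd (b i)) :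
    (Finset.univ.filter fun i => p ^ (j + 1) ∣ a i).card =
      (Finset.univ.filter fun i => p ^ (j + 1) ∣ b i).card := by
  rw [Finset.prod_congr rfl fun i _ => gcd_pow_succ hp (a i) j,
    Finset.prod_congr rfl fun i _ => gcd_pow_succ hp (b i) j] at h1
  simp only [Finset.prod_mul_distrib, Finset.prod_pow_eq_pow_sum] at h1
  rw [h0] at h1
  have hpos : 0 < ∏ i, (p ^ j).gcd (b i) :=
    Finset.prod_pos fun i _ => Nat.gcd_pos_of_pos_left _ (pow_pos hp.pos _)
  have h2 := Nat.pow_right_injective hp.two_le (Nat.eq_of_mul_eq_mul_left hpos h1)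
  rw [Finset.card_filter, Finset.card_filter]
  exact h2

lemma exists_perm {n : ℕ} (v k : Fin n → ℕ)
    (h : ∀ j, (Finset.univ.filter fun i => j + 1 ≤ v i).card =
      (Finset.univ.filter fun i => j + 1 ≤ k i).card) :
    ∃ σ : Equiv.Perm (Fin n), ∀ i, v (σ i) = k i := by
  have h' : ∀ j, (Finset.univ.filter fun i => j ≤ v i).card =
      (Finset.univ.filter fun i => j ≤ k i).card := by
    rintro (_ | j)
    · simp
    · exact h j
  have hs : ∀ (w : Fin n → ℕ) j, (Finset.univ.filter fun i => j ≤ w i).card =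
      (Finset.univ.filter fun i => w i = j).card +
      (Finset.univ.filter fun i => j + 1 ≤ w i).card := by
    intro w j
    rw [← Finset.card_union_of_disjoint]
    · congr 1
      ext i
      simp
      omega
    · rw [Finset.disjoint_filter]
      intro i _ h
      omega
  have hc : ∀ j, Fintype.card {i // k i = j} = Fintype.card {i // v i = j} := by
    intro j
    rw [Fintype.card_subtype, Fintype.card_subtype]
    have h1 := hs v j
    have h2 := hs k j
    have h3 := h' j
    have h4 := h' (j + 1)
    omega
  refine ⟨Equiv.ofFiberEquiv fun c => Fintype.equivOfCardEq (hc c), fun i => ?_⟩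
  exact Equiv.ofFiberEquiv_map _ i

lemma ordp_int_ge {p : ℕ} (hp : p.Prime) (m : ℕ) (z : ℤ) (h : (p : ℤ) ^ m ∣ z) :
    ((m : ℤ) : WithTop ℤ) ≤ ordp p (z : ℚ) := by
  have : Fact p.Prime := ⟨hp⟩
  unfold ordp
  split_ifs with h0
  · exact le_top
  · rw [padicValRat.of_int]
    have hz : z ≠ 0 := by exact_mod_cast h0
    have := (padicValInt_dvd_iff m z).mp h
    have h2 : m ≤ padicValInt p z := by tauto
    exact_mod_cast h2

lemma ordp_quot_nonneg {p : ℕ} (hp : p.Prime) (k : ℕ) (a d : ℤ) (hd : ¬ (p : ℤ) ∣ d)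
    (h : (p : ℤ) ^ k ∣ a) : (0 : WithTop ℤ) ≤ ordp p ((a : ℚ) / ((d : ℚ) * (p : ℚ) ^ k)) := by
  have : Fact p.Prime := ⟨hp⟩
  have hp0 : (p : ℚ) ≠ 0 := by exact_mod_cast hp.ne_zero
  obtain ⟨b, rfl⟩ := h
  have hd0 : (d : ℚ) ≠ 0 := by
    intro h; apply hd; rw [show d = 0 by exact_mod_cast h]; exact dvd_zero _
  have e : (((p : ℤ) ^ k * b : ℤ) : ℚ) / ((d : ℚ) * (p : ℚ) ^ k) = (b : ℚ) / d := by
    push_cast; field_simp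
  rw [e]
  unfold ordp
  split_ifs with h0
  · exact le_top
  · have hb : (b : ℚ) ≠ 0 := by rintro hb; simp [hb] at h0
    rw [padicValRat.div hb hd0, padicValRat.of_int, padicValRat.of_int,
      padicValInt.eq_zero_of_not_dvd hd]
    simp only [Nat.cast_zero, sub_zero]
    exact_mod_cast Nat.zero_le _

lemma ordp_quot_eq {p : ℕ} (hp : p.Prime) (k : ℕ) (a d : ℤ) (hd : ¬ (p : ℤ) ∣ d)
    (h : ¬ (p : ℤ) ∣ a) :
    ordp p ((a : ℚ) / ((d : ℚ) * (p : ℚ) ^ k)) = ((-(k : ℤ) : ℤ) : WithTop ℤ) := by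
  have : Fact p.Prime := ⟨hp⟩
  have hp0 : (p : ℚ) ≠ 0 := by exact_mod_cast hp.ne_zero
  have hd0 : (d : ℚ) ≠ 0 := by
    intro h; apply hd; rw [show d = 0 by exact_mod_cast h]; exact dvd_zero _
  have ha0 : (a : ℚ) ≠ 0 := by
    intro h'; apply h; rw [show a = 0 by exact_mod_cast h']; exact dvd_zero _
  unfold ordp
  rw [if_neg (by positivity)]
  rw [padicValRat.div ha0 (by positivity), padicValRat.mul hd0 (by positivity),
    padicValRat.of_int, padicValRat.of_int, padicValInt.eq_zero_of_not_dvd hd,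
    padicValInt.eq_zero_of_not_dvd h, padicValRat.pow, padicValRat.self hp.one_lt]
  simp

lemma final_inv {n : ℕ} {p : ℕ} (hp : p.Prime) (A : Matrix (Fin n) (Fin n) ℤ) (k : Fin n → ℕ)
    (K : ℕ) (hK : ∀ i, k i ≤ K) (w : Fin n → ℤ) (hw : ∀ i, ¬ (p : ℤ) ∣ w i)
    (hd : ∀ i, A i i = (p : ℤ) ^ k i * w i)
    (ho : ∀ i j, i ≠ j → (p : ℤ) ^ (2 * K + 1) ∣ A i j) :
    (∀ i j : Fin n, i ≠ j →
      (0 : WithTop ℤ) ≤ ordp p (((A.map (Int.cast : ℤ → ℚ))⁻¹) i j)) ∧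
    (∀ i : Fin n,
      ordp p (((A.map (Int.cast : ℤ → ℚ))⁻¹) i i) = ((-(k i : ℤ) : ℤ) : WithTop ℤ)) := by
  have : Fact p.Prime := ⟨hp⟩
  have hpp := Nat.prime_iff_prime_int.mp hp
  have hp0 : (p : ℚ) ≠ 0 := by exact_mod_cast hp.ne_zero
  have hW : ∀ i j, ∃ x : ℤ, A i j = (p : ℤ) ^ k i * x ∧
      (i = j → x = w i) ∧ (i ≠ j → (p : ℤ) ^ (K + 1) ∣ x) := by
    intro i j
    by_cases h : i = j
    · subst h
      exact ⟨w i, hd i, fun _ => rfl, fun h => absurd rfl h⟩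
    · obtain ⟨y, hy⟩ := ho i j h
      have hki := hK i
      refine ⟨p ^ (2 * K + 1 - k i) * y, ?_, fun h' => absurd h' h, fun _ => ?_⟩
      · rw [hy, ← mul_assoc, ← pow_add]
        congr 2
        omega
      · exact Dvd.dvd.mul_right (pow_dvd_pow _ (by omega)) _
  choose W hWA hWd hWo using hW
  set V : Matrix (Fin n) (Fin n) ℤ := Matrix.of W with hV
  have hVV : ∀ i j, V i j = W i j := fun _ _ => rfl
  have hdet : ¬ (p : ℤ) ∣ V.det := by
    rw [← ZMod.intCast_zmod_eq_zero_iff_dvd]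
    have e : ((V.det : ℤ) : ZMod p) = ((Int.castRingHom (ZMod p)).mapMatrix V).det := by
      rw [← RingHom.map_det]; rfl
    have e2 : (Int.castRingHom (ZMod p)).mapMatrix V =
        Matrix.diagonal fun i => ((w i : ℤ) : ZMod p) := by
      ext i j
      by_cases h : i = j
      · subst h
        simp [hVV, hWd i i rfl]
      · simp only [RingHom.mapMatrix_apply, Matrix.map_apply, hVV, Matrix.diagonal_apply_ne _ h,
          eq_intCast]
        rw [ZMod.intCast_zmod_eq_zero_iff_dvd]
        exact (dvd_pow_self _ (Nat.succ_ne_zero K)).trans (hWo i j h)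
    rw [e, e2, Matrix.det_diagonal, Finset.prod_eq_zero_iff]
    rintro ⟨i, _, hi⟩
    rw [ZMod.intCast_zmod_eq_zero_iff_dvd] at hi
    exact hw i hi
  have hdet0 : (V.det : ℚ) ≠ 0 := by
    intro h; apply hdet; rw [show V.det = 0 by exact_mod_cast h]; exact dvd_zero _
  have hinv : (A.map (Int.cast : ℤ → ℚ))⁻¹ =
      Matrix.of fun i j => (V.adjugate i j : ℚ) / ((V.det : ℚ) * (p : ℚ) ^ k j) := by
    apply Matrix.inv_eq_right_inv
    ext i j
    have hadj : ∑ l, V i l * V.adjugate l j = V.det * (1 : Matrix (Fin n) (Fin n) ℤ) i j := by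
      rw [← Matrix.mul_apply, Matrix.mul_adjugate]; simp
    have hadj' : ∑ l, (V i l : ℚ) * (V.adjugate l j : ℚ) =
        (V.det : ℚ) * (1 : Matrix (Fin n) (Fin n) ℚ) i j := by
      have := congrArg (Int.cast : ℤ → ℚ) hadj
      simp only [Int.cast_sum, Int.cast_mul] at this
      rw [this]
      simp [Matrix.one_apply]
    have : ((A.map (Int.cast : ℤ → ℚ)) *
        Matrix.of fun i j => (V.adjugate i j : ℚ) / ((V.det : ℚ) * (p : ℚ) ^ k j)) i j =
        (p : ℚ) ^ k i / ((V.det : ℚ) * (p : ℚ) ^ k j) *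
          ∑ l, (V i l : ℚ) * (V.adjugate l j : ℚ) := by
      rw [Matrix.mul_apply, Finset.mul_sum]
      refine Finset.sum_congr rfl fun l _ => ?_
      simp only [Matrix.map_apply, Matrix.of_apply, hWA i l, hVV]
      push_cast
      ring
    rw [this, hadj']
    by_cases h : i = j
    · subst h
      rw [Matrix.one_apply_eq]
      field_simp
    · rw [Matrix.one_apply_ne h]
      simp
  have hsum : ∀ i j, (p : ℤ) ^ (K + 1) ∣
      V.det * (1 : Matrix (Fin n) (Fin n) ℤ) i j - V.adjugate i j * w j := by
    intro i j
    have hadj : ∑ l, V.adjugate i l * V l j = V.det * (1 : Matrix (Fin n) (Fin n) ℤ) i j := by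
      rw [← Matrix.mul_apply, Matrix.adjugate_mul]; simp
    rw [← hadj, ← Finset.add_sum_erase _ _ (Finset.mem_univ j), hVV, hWd j j rfl,
      add_sub_cancel_left]
    refine Finset.dvd_sum fun l hl => Dvd.dvd.mul_left (hWo l j (Finset.ne_of_mem_erase hl)) _
  rw [hinv]
  constructor
  · intro i j hij
    apply ordp_quot_nonneg hp _ _ _ hdet
    have h := hsum i j
    rw [Matrix.one_apply_ne hij, mul_zero, zero_sub, dvd_neg] at h
    have hco : IsCoprime ((p : ℤ) ^ (K + 1)) (w j) :=
      (hpp.coprime_iff_not_dvd.mpr (hw j)).pow_left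
    exact (pow_dvd_pow _ ((hK j).trans (Nat.le_succ K))).trans (hco.dvd_of_dvd_mul_right h)
  · intro i
    apply ordp_quot_eq hp _ _ _ hdet
    intro hcon
    have h := (dvd_pow_self (p : ℤ) (Nat.succ_ne_zero K)).trans (hsum i i)
    rw [Matrix.one_apply_eq, mul_one] at h
    exact hdet ((dvd_sub_left (Dvd.dvd.mul_right hcon _)).mp h)

/-- Let `M` be a symmetric `n × n` integer matrix with nonzero determinant, `p` an odd prime,
`0 ≤ k 1 ≤ … ≤ k n` and `q ≥ 1` coprime to `p` such that the cokernel `ℤⁿ/Mℤⁿ` is isomorphic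
to `ℤ/p^(k 1) ⊕ … ⊕ ℤ/p^(k n) ⊕ ℤ/q`. Then there is a unimodular integer matrix `T` such that
the entries of `(T * M * Tᵀ)⁻¹` have `ord_p ≥ 0` off the diagonal and `ord_p = -k i` at the
`i`-th diagonal entry, while the entries of `T * M * Tᵀ` have `ord_p ≥ k i + k j` off the
diagonal and `ord_p ≥ k i` on the diagonal. -/
theorem stmt_3 (n : ℕ) (M : Matrix (Fin n) (Fin n) ℤ) (hsymm : M.IsSymm) (hdet : M.det ≠ 0)
    (p : ℕ) (hp : p.Prime) (hp2 : p ≠ 2) (k : Fin n → ℕ) (hk : Monotone k)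
    (q : ℕ) (hq : 1 ≤ q) (hpq : ¬ p ∣ q)
    (hcoker : Nonempty (((Fin n → ℤ) ⧸ LinearMap.range (Matrix.mulVecLin M)) ≃+
      ((∀ i : Fin n, ZMod (p ^ k i)) × ZMod q))) :
    ∃ T : Matrix (Fin n) (Fin n) ℤ, (T.det = 1 ∨ T.det = -1) ∧
      (∀ i j : Fin n, i ≠ j → (0 : WithTop ℤ) ≤ ordp p ((((T * M * Tᵀ).map (Int.cast : ℤ → ℚ))⁻¹) i j)) ∧
      (∀ i : Fin n, ordp p ((((T * M * Tᵀ).map (Int.cast : ℤ → ℚ))⁻¹) i i) = ((-(k i : ℤ) : ℤ) : WithTop ℤ)) ∧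
      (∀ i j : Fin n, i ≠ j → (((k i : ℤ) + (k j : ℤ) : ℤ) : WithTop ℤ) ≤ ordp p (((T * M * Tᵀ) i j : ℤ) : ℚ)) ∧
      (∀ i : Fin n, ((k i : ℤ) : WithTop ℤ) ≤ ordp p (((T * M * Tᵀ) i i : ℤ) : ℚ)) := by
  obtain ⟨K, hK⟩ : ∃ K, ∀ i, k i ≤ K :=
    ⟨∑ i, k i, fun i => Finset.single_le_sum (fun _ _ => Nat.zero_le _) (Finset.mem_univ i)⟩
  obtain ⟨A, hMA, hA⟩ := diag_exists hp hp2 (2 * K + 1) M hsymm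
  have hg := gcd_prod_eq M A hMA p hp k q hpq hcoker (2 * K + 1) hA
  have hcnt : ∀ j, j ≤ K → (Finset.univ.filter fun i => p ^ (j + 1) ∣ (A i i).natAbs).card =
      (Finset.univ.filter fun i => j + 1 ≤ k i).card := by
    intro j hj
    have := count_eq hp (fun i => (A i i).natAbs) (fun i => p ^ k i) j (hg j (by omega))
      (hg (j + 1) (by omega))
    simpa only [Nat.pow_dvd_pow_iff_le_right hp.one_lt] using this
  have hnd : ∀ i, ¬ p ^ (K + 1) ∣ (A i i).natAbs := by
    intro i hi
    have h := hcnt K le_rfl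
    have h0 : (Finset.univ.filter fun i => K + 1 ≤ k i).card = 0 := by
      rw [Finset.card_eq_zero, Finset.filter_eq_empty_iff]
      intro i _
      have := hK i
      omega
    rw [h0, Finset.card_eq_zero, Finset.filter_eq_empty_iff] at h
    exact h (Finset.mem_univ i) hi
  have hne : ∀ i, (A i i).natAbs ≠ 0 := by
    intro i h
    apply hnd i
    rw [h]
    exact dvd_zero _
  have hv : ∀ i j, p ^ j ∣ (A i i).natAbs ↔ j ≤ (A i i).natAbs.factorization p :=
    fun i j => hp.pow_dvd_iff_le_factorization (hne i)
  obtain ⟨σ, hσ⟩ := exists_perm (fun i => (A i i).natAbs.factorization p) k (by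
    intro j
    simp_rw [← hv]
    by_cases hj : j ≤ K
    · exact hcnt j hj
    · rw [Finset.filter_eq_empty_iff.mpr, Finset.filter_eq_empty_iff.mpr]
      · intro i _
        have := hK i
        omega
      · intro i _ hd
        exact hnd i ((pow_dvd_pow _ (by omega)).trans hd))
  have hw : ∀ i, ∃ w : ℤ, ¬ (p : ℤ) ∣ w ∧ A (σ i) (σ i) = (p : ℤ) ^ k i * w := by
    intro i
    have h1 : (p : ℤ) ^ k i ∣ A (σ i) (σ i) := by
      have := (hv (σ i) (k i)).mpr (hσ i).ge
      rw [← Int.natCast_dvd] at this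
      exact_mod_cast this
    obtain ⟨w, hw⟩ := h1
    refine ⟨w, ?_, hw⟩
    intro hpw
    have h2 : (p : ℤ) ^ (k i + 1) ∣ A (σ i) (σ i) := by
      rw [hw, pow_succ]; exact mul_dvd_mul_left _ hpw
    have h3 : p ^ (k i + 1) ∣ (A (σ i) (σ i)).natAbs := by
      rw [← Int.natCast_dvd]; exact_mod_cast h2
    have h4 := (hv _ _).mp h3
    have h5 := hσ i
    omega
  choose w hw1 hw2 using hw
  obtain ⟨T, hT, hB⟩ := hMA.trans (UCong.perm A σ)
  have ho : ∀ i j, i ≠ j → (p : ℤ) ^ (2 * K + 1) ∣ (A.submatrix σ σ) i j := fun i j hij =>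
    hA _ _ (fun h => hij (σ.injective h))
  obtain ⟨hi1, hi2⟩ := final_inv hp (A.submatrix σ σ) k K hK w hw1 hw2 ho
  refine ⟨T, hT, ?_, ?_, ?_, ?_⟩ <;> rw [← hB]
  · exact hi1
  · exact hi2
  · intro i j hij
    have := ordp_int_ge hp (k i + k j) _
      ((pow_dvd_pow (p : ℤ) (by have := hK i; have := hK j; omega)).trans (ho i j hij))
    exact_mod_cast this
  · intro i
    exact ordp_int_ge hp (k i) _ ⟨w i, hw2 i⟩
end

section
/- Let p be an odd prime, g ≥ 1, and let M be a symmetric 2g×2g integer matrix with all diagonal entries even and with odd determinant. Write |det(M)| = p^α·q with α ≥ 0 and p ∤ q. Let m ∈ {0,…,2g} and let k_1,…,k_{2g} be non-negative integers with k_i = 0 for i ≤ 2g−m, k_i ≥ 1 for i > 2g−m, and k_1 + … + k_{2g} = α. Assume that the rational matrix M^{−1} satisfies ord_p((M^{−1})_{ij}) ≥ 0 for all i ≠ j and ord_p((M^{−1})_{ii}) = −k_i for all i, and that the entries of M satisfy ord_p(M_{ij}) ≥ k_i + k_j for i ≠ j and ord_p(M_{ii}) ≥ k_i. For each i > 2g−m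 write (M^{−1})_{ii} = s_i/t_i with s_i, t_i coprime integers and t_i > 0, so that p^{k_i} divides t_i. Let N denote the upper left (2g−m)×(2g−m) submatrix of M. Then: det(N) is not divisible by p; the dimension over 𝔽_p of the kernel of M modulo p equals m; and the Legendre symbols satisfy ( (−1)^{m+g}·det N | p ) = ( q | p ) · Π_{i=2g−m+1}^{2g} ( s_i·(t_i/p^{k_i}) | p ) · (−1)^{((p−1)/2)·(α + m + (q−1)/2)}. -/
open Matrix

/-- The dimension over `𝔽_p` of the kernel of the reduction of an integer matrix modulo `p`. -/
noncomputable def kerDimModP (p : ℕ) {n : ℕ} (M : Matrix (Fin n) (Fin n) ℤ) : ℕ :=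
  Module.finrank (ZMod p)
    (LinearMap.ker (Matrix.mulVecLin (M.map (Int.cast : ℤ → ZMod p))))

/-- The upper left `r × r` submatrix of an `n × n` matrix, for `r ≤ n`. -/
def upperLeft {n : ℕ} (M : Matrix (Fin n) (Fin n) ℤ) (r : ℕ) (h : r ≤ n) :
    Matrix (Fin r) (Fin r) ℤ :=
  M.submatrix (Fin.castLE h) (Fin.castLE h)

lemma z4_step {n : ℕ} (M : Matrix (Fin 2 ⊕ Fin n) (Fin 2 ⊕ Fin n) (ZMod 4))
    (hs : M.IsSymm) (hd : ∀ i, ∃ c, M i i = 2 * c)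
    (hu : IsUnit (M (Sum.inl 0) (Sum.inl 1))) :
    ∃ S : Matrix (Fin n) (Fin n) (ZMod 4), S.IsSymm ∧ (∀ i, ∃ c, S i i = 2 * c) ∧
      M.det = - S.det := by
  obtain ⟨a, ha⟩ := hd (Sum.inl 0)
  obtain ⟨c, hc⟩ := hd (Sum.inl 1)
  set b := M (Sum.inl 0) (Sum.inl 1) with hb
  have hb' : M (Sum.inl 1) (Sum.inl 0) = b := hs.apply _ _
  have key : ∀ a b c : ZMod 4, IsUnit b → 2 * a * (2 * c) - b * b = -1 := by decide
  have hbb := key a b c hu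
  have hA : M.toBlocks₁₁ = !![2 * a, b; b, 2 * c] := by
    ext i j
    fin_cases i <;> fin_cases j <;> simp [Matrix.toBlocks₁₁, ha, hc, hb', hb]
  let Bi : Matrix (Fin 2) (Fin 2) (ZMod 4) := !![-(2 * c), b; b, -(2 * a)]
  have h1 : M.toBlocks₁₁ * Bi = 1 := by
    rw [hA]
    ext i j
    fin_cases i <;> fin_cases j <;> simp [Bi, Matrix.mul_apply, Fin.sum_univ_two] <;>
      first | ring1 | linear_combination -hbb
  have h2 : Bi * M.toBlocks₁₁ = 1 := mul_eq_one_comm.mp h1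
  let _ : Invertible M.toBlocks₁₁ := ⟨Bi, h2, h1⟩
  have hinv : ⅟ M.toBlocks₁₁ = Bi := rfl
  have hdet : M.toBlocks₁₁.det = -1 := by
    rw [hA, Matrix.det_fin_two_of]; exact hbb
  have hSx : ∀ i j, (M.toBlocks₂₂ - M.toBlocks₂₁ * Bi * M.toBlocks₁₂) i j =
      M (Sum.inr i) (Sum.inr j) + (2 * c) * (M (Sum.inl 0) (Sum.inr i) * M (Sum.inl 0) (Sum.inr j))
      - b * (M (Sum.inl 0) (Sum.inr i) * M (Sum.inl 1) (Sum.inr j))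
      - b * (M (Sum.inl 1) (Sum.inr i) * M (Sum.inl 0) (Sum.inr j))
      + (2 * a) * (M (Sum.inl 1) (Sum.inr i) * M (Sum.inl 1) (Sum.inr j)) := by
    intro i j
    simp only [Matrix.sub_apply, Matrix.mul_apply, Fin.sum_univ_two, Bi, Matrix.toBlocks₂₂,
      Matrix.toBlocks₂₁, Matrix.toBlocks₁₂, Matrix.of_apply]
    rw [hs.apply (Sum.inl 0) (Sum.inr i), hs.apply (Sum.inl 1) (Sum.inr i)]
    simp
    ring
  refine ⟨M.toBlocks₂₂ - M.toBlocks₂₁ * Bi * M.toBlocks₁₂, ?_, ?_, ?_⟩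
  · ext i j
    rw [Matrix.transpose_apply, hSx, hSx, hs.apply (Sum.inr i) (Sum.inr j)]
    ring
  · intro i
    obtain ⟨e, he⟩ := hd (Sum.inr i)
    rw [hSx, he]
    refine ⟨e + c * (M (Sum.inl 0) (Sum.inr i) * M (Sum.inl 0) (Sum.inr i))
      - b * (M (Sum.inl 0) (Sum.inr i) * M (Sum.inl 1) (Sum.inr i))
      + a * (M (Sum.inl 1) (Sum.inr i) * M (Sum.inl 1) (Sum.inr i)), by ring⟩
  · conv_lhs => rw [← Matrix.fromBlocks_toBlocks M]
    rw [Matrix.det_fromBlocks₁₁, hinv, hdet]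
    ring

lemma z4_det (g : ℕ) : ∀ M : Matrix (Fin (2 * g)) (Fin (2 * g)) (ZMod 4), M.IsSymm →
    (∀ i, ∃ c, M i i = 2 * c) → IsUnit M.det → M.det = (-1) ^ g := by
  induction g with
  | zero => intro M _ _ _; simp
  | succ g ih =>
    intro M hs hd hu
    let e0 : Fin 2 ⊕ Fin (2 * g) ≃ Fin (2 * (g + 1)) :=
      finSumFinEquiv.trans (finCongr (by ring))
    set i0 := e0 (Sum.inl 0) with hi0
    obtain ⟨j, hj⟩ : ∃ j, IsUnit (M i0 j) := by
      by_contra! h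
      have key : ∀ x : ZMod 4, ¬ IsUnit x → ∃ c, x = 2 * c := by decide
      choose f hf using fun j => key _ (h j)
      have hM : M = M.updateRow i0 ((2 : ZMod 4) • f) := by
        ext i j
        by_cases hi : i = i0
        · subst hi; simp [hf]
        · simp [Matrix.updateRow_ne hi]
      rw [hM, Matrix.det_updateRow_smul] at hu
      have : ∀ x : ZMod 4, ¬ IsUnit (2 * x) := by decide
      exact this _ hu
    have hji : j ≠ i0 := by
      rintro rfl
      obtain ⟨c, hc⟩ := hd i0
      rw [hc] at hj
      have : ∀ x : ZMod 4, ¬ IsUnit (2 * x) := by decide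
      exact this _ hj
    let e : Fin 2 ⊕ Fin (2 * g) ≃ Fin (2 * (g + 1)) := e0.trans (Equiv.swap (e0 (Sum.inl 1)) j)
    have he0 : e (Sum.inl 0) = i0 := by
      simp only [e, Equiv.trans_apply]
      rw [← hi0, Equiv.swap_apply_of_ne_of_ne _ hji.symm]
      simp [hi0]
    have he1 : e (Sum.inl 1) = j := by simp [e]
    obtain ⟨S, hS, hSd, hdet⟩ := z4_step (M.submatrix e e) (hs.submatrix e)
      (fun i => hd (e i)) (by simpa [he0, he1] using hj)
    rw [Matrix.det_submatrix_equiv_self] at hdet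
    rw [hdet] at hu ⊢
    rw [ih S hS hSd (by simpa using hu)]
    ring

lemma int_det_mod4 (g : ℕ) (M : Matrix (Fin (2 * g)) (Fin (2 * g)) ℤ) (hs : M.IsSymm)
    (hd : ∀ i, Even (M i i)) (ho : Odd M.det) : ((M.det : ℤ) : ZMod 4) = (-1) ^ g := by
  have h := z4_det g (M.map (Int.castRingHom (ZMod 4))) (hs.map _) ?_ ?_
  · rw [← h, ← RingHom.mapMatrix_apply, ← RingHom.map_det]; rfl
  · intro i
    obtain ⟨c, hc⟩ := hd i
    exact ⟨c, by simp [hc, two_mul]⟩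
  · rw [← RingHom.mapMatrix_apply, ← RingHom.map_det]
    obtain ⟨c, hc⟩ := ho
    rw [hc]
    have : ∀ x : ZMod 4, IsUnit (2 * x + 1) := by decide
    simpa using this (c : ZMod 4)

lemma dvd_of_ordp {p : ℕ} [Fact p.Prime] {n : ℕ} {z : ℤ}
    (h : ((n : ℤ) : WithTop ℤ) ≤ ordp p ((z : ℤ) : ℚ)) : (p : ℤ) ^ n ∣ z := by
  rw [padicValInt_dvd_iff]
  by_cases hz : z = 0
  · exact Or.inl hz
  · right
    rw [ordp, if_neg (by exact_mod_cast hz), padicValRat.of_int] at h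
    exact_mod_cast h

lemma z4_odd (n : ℕ) (h : Odd n) : (n : ZMod 4) = (-1) ^ ((n - 1) / 2) := by
  obtain ⟨c, rfl⟩ := h
  have : (2 * c + 1 - 1) / 2 = c := by omega
  rw [this]
  induction c with
  | zero => simp
  | succ c ih =>
    rw [pow_succ, ← ih (by omega)]
    push_cast
    have : ∀ x : ZMod 4, 2 * (x + 1) + 1 = (2 * x + 1) * -1 := by decide
    exact this _

lemma z4_parity (a b : ℕ) (h : (-1 : ZMod 4) ^ a = (-1) ^ b) : Even a ↔ Even b := by
  rcases Nat.even_or_odd a with ha | ha <;> rcases Nat.even_or_odd b with hb | hb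
  · simp [ha, hb]
  · rw [ha.neg_one_pow, hb.neg_one_pow] at h; exact absurd h (by decide)
  · rw [ha.neg_one_pow, hb.neg_one_pow] at h; exact absurd h (by decide)
  · simp [Nat.not_even_iff_odd.mpr ha, Nat.not_even_iff_odd.mpr hb]

lemma sign_parity (h e g m α r : ℕ) (H : Even (e + h * α + r) ↔ Even g) :
    (-1 : ℤ) ^ (h * (m + g) + h * e) = (-1) ^ (h * (α + m + r)) := by
  have : Even (h * (m + g) + h * e) ↔ Even (h * (α + m + r)) := by
    simp only [Nat.even_add, Nat.even_mul] at H ⊢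
    tauto
  rcases Nat.even_or_odd (h * (m + g) + h * e) with ha | ha
  · rw [ha.neg_one_pow, (this.mp ha).neg_one_pow]
  · have hb : Odd (h * (α + m + r)) := by
      rw [← Nat.not_even_iff_odd] at ha ⊢; tauto
    rw [ha.neg_one_pow, hb.neg_one_pow]

/-- The matrix-level content of the paper's Proposition relating the singular determinant
`δ_p(M)` to the linking form presented by `M`: for a symmetric `2g × 2g` integer matrix `M`
with even diagonal and odd determinant `±p^α·q` (`p ∤ q`), whose rational inverse has been
normalized as in the paper (off-diagonal entries of `M⁻¹` are `p`-integral, diagonal entries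
have valuations `-k_i`, entries of `M` have valuations at least `k_i + k_j` resp. `k_i`),
with `(M⁻¹)_{ii} = s_i/t_i` in lowest terms for `i > 2g - m`, the upper left
`(2g-m) × (2g-m)` submatrix `N` of `M` has determinant prime to `p`, the mod-`p` kernel of
`M` has dimension `m`, and
`((-1)^(m+g)·det N | p) = (q | p) · Π_{i>2g-m} (s_i·(t_i/p^{k_i}) | p) ·
(-1)^(((p-1)/2)·(α + m + (q-1)/2))`. -/
theorem stmt_15 (p : ℕ) [Fact p.Prime] (hp2 : p ≠ 2) (g : ℕ) (hg : 1 ≤ g)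
    (M : Matrix (Fin (2 * g)) (Fin (2 * g)) ℤ) (hsymm : M.IsSymm)
    (hdiag : ∀ i, Even (M i i)) (hodd : Odd M.det)
    (α q : ℕ) (hdet : M.det.natAbs = p ^ α * q) (hpq : ¬ p ∣ q)
    (m : ℕ) (hm : m ≤ 2 * g)
    (k : Fin (2 * g) → ℕ)
    (hk0 : ∀ i : Fin (2 * g), (i : ℕ) < 2 * g - m → k i = 0)
    (hk1 : ∀ i : Fin (2 * g), 2 * g - m ≤ (i : ℕ) → 1 ≤ k i)
    (hkα : ∑ i : Fin (2 * g), k i = α)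
    (hinvoff : ∀ i j : Fin (2 * g), i ≠ j →
      (0 : WithTop ℤ) ≤ ordp p (((M.map (Int.cast : ℤ → ℚ))⁻¹) i j))
    (hinvdiag : ∀ i : Fin (2 * g),
      ordp p (((M.map (Int.cast : ℤ → ℚ))⁻¹) i i) = ((-(k i : ℤ) : ℤ) : WithTop ℤ))
    (hMoff : ∀ i j : Fin (2 * g), i ≠ j →
      (((k i : ℤ) + (k j : ℤ) : ℤ) : WithTop ℤ) ≤ ordp p ((M i j : ℤ) : ℚ))
    (hMdiag : ∀ i : Fin (2 * g), ((k i : ℤ) : WithTop ℤ) ≤ ordp p ((M i i : ℤ) : ℚ))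
    (s t : Fin (2 * g) → ℤ)
    (hst : ∀ i : Fin (2 * g), 2 * g - m ≤ (i : ℕ) →
      Int.gcd (s i) (t i) = 1 ∧ 0 < t i ∧
        ((M.map (Int.cast : ℤ → ℚ))⁻¹) i i = (s i : ℚ) / (t i : ℚ)) :
    ¬ (p : ℤ) ∣ (upperLeft M (2 * g - m) (Nat.sub_le (2 * g) m)).det ∧
    kerDimModP p M = m ∧
    legendreSym p ((-1) ^ (m + g) * (upperLeft M (2 * g - m) (Nat.sub_le (2 * g) m)).det) =
      legendreSym p (q : ℤ) *
      (∏ i ∈ Finset.univ.filter (fun i : Fin (2 * g) => 2 * g - m ≤ (i : ℕ)),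
        legendreSym p (s i * (t i / (p : ℤ) ^ k i))) *
      (-1) ^ (((p - 1) / 2) * (α + m + (q - 1) / 2)) := by
  classical
  have hpp : p.Prime := Fact.out
  have hpZ : (p : ℤ) ≠ 0 := by exact_mod_cast hpp.ne_zero
  have hcol : ∀ i j, (p : ℤ) ^ k j ∣ M i j := by
    intro i j
    by_cases hij : i = j
    · subst hij; exact dvd_of_ordp (hMdiag i)
    · refine (pow_dvd_pow _ (Nat.le_add_left (k j) (k i))).trans (dvd_of_ordp ?_)
      have := hMoff i j hij
      exact_mod_cast this
  choose A hA using hcol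
  have hMA : M = Matrix.of A * Matrix.diagonal (fun j => (p : ℤ) ^ k j) := by
    ext i j
    rw [Matrix.mul_diagonal, hA i j, Matrix.of_apply, mul_comm]
  set B : Matrix (Fin (2 * g)) (Fin (2 * g)) ℤ := Matrix.of A with hB
  have hBoff : ∀ i j : Fin (2 * g), i ≠ j → 2 * g - m ≤ (i : ℕ) → (p : ℤ) ∣ B i j := by
    intro i j hij hi
    have h1 : (p : ℤ) ^ (k i + k j) ∣ M i j := by
      apply dvd_of_ordp
      have := hMoff i j hij
      exact_mod_cast this
    rw [hA i j, pow_add, mul_comm] at h1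
    have h2 := (mul_dvd_mul_iff_left (pow_ne_zero (k j) hpZ)).mp h1
    exact (dvd_pow_self _ (by have := hk1 i hi; omega)).trans h2
  have hdetM : M.det = B.det * (p : ℤ) ^ α := by
    conv_lhs => rw [hMA]
    rw [Matrix.det_mul, Matrix.det_diagonal, Finset.prod_pow_eq_pow_sum, hkα]
  obtain ⟨e, he⟩ : ∃ e : ℕ, B.det = (-1) ^ e * (q : ℤ) := by
    have h1 : B.det.natAbs = q := by
      rw [hdetM, Int.natAbs_mul, Int.natAbs_pow, Int.natAbs_natCast, mul_comm] at hdet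
      exact Nat.eq_of_mul_eq_mul_left (pow_pos hpp.pos α) hdet
    rcases Int.natAbs_eq B.det with h | h
    · exact ⟨0, by rw [h, h1]; simp⟩
    · exact ⟨1, by rw [h, h1]; simp⟩
  have hq0 : ((q : ℤ) : ZMod p) ≠ 0 := by
    rw [Ne, ZMod.intCast_zmod_eq_zero_iff_dvd]; exact_mod_cast hpq
  have hd0 : ((B.det : ℤ) : ZMod p) ≠ 0 := by
    rw [he]; push_cast
    exact mul_ne_zero (pow_ne_zero _ (neg_ne_zero.mpr one_ne_zero)) (by exact_mod_cast hq0)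
  -- reduction mod p
  set Bp : Matrix (Fin (2 * g)) (Fin (2 * g)) (ZMod p) := B.map (Int.castRingHom (ZMod p)) with hBp
  have hBpdet : Bp.det = ((B.det : ℤ) : ZMod p) := by
    rw [hBp, ← RingHom.mapMatrix_apply, ← RingHom.map_det]; rfl
  have hBpoff : ∀ i j : Fin (2 * g), i ≠ j → 2 * g - m ≤ (i : ℕ) → Bp i j = 0 := by
    intro i j hij hi
    simpa [hBp] using (ZMod.intCast_zmod_eq_zero_iff_dvd (B i j) p).mpr (hBoff i j hij hi)
  set N := upperLeft M (2 * g - m) (Nat.sub_le (2 * g) m) with hN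
  let P : Fin (2 * g) → Prop := fun i => (i : ℕ) < 2 * g - m
  have hblock : Bp.det = ((N.det : ℤ) : ZMod p) *
      ∏ i ∈ Finset.univ.filter (fun i : Fin (2 * g) => 2 * g - m ≤ (i : ℕ)), Bp i i := by
    rw [Matrix.twoBlockTriangular_det Bp P ?_]
    · congr 1
      · let f : Fin (2 * g - m) ≃ {i // P i} :=
          { toFun := fun i => ⟨Fin.castLE (Nat.sub_le (2 * g) m) i, i.2⟩
            invFun := fun i => ⟨i.1, i.2⟩
            left_inv := fun i => rfl
            right_inv := fun i => rfl }
        rw [← Matrix.det_submatrix_equiv_self f]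
        have : ((N.det : ℤ) : ZMod p) = (N.map (Int.castRingHom (ZMod p))).det := by
          rw [← RingHom.mapMatrix_apply, ← RingHom.map_det]; rfl
        rw [this]
        congr 1
        ext i j
        have h1 := hA (Fin.castLE (Nat.sub_le (2 * g) m) i) (Fin.castLE (Nat.sub_le (2 * g) m) j)
        rw [hk0 (Fin.castLE (Nat.sub_le (2 * g) m) j) j.2, pow_zero, one_mul] at h1
        simp [f, hN, upperLeft, Matrix.toSquareBlockProp, hBp, hB, h1]
      · have : (Bp.toSquareBlockProp fun i => ¬ P i) =
            Matrix.diagonal (fun i : {i // ¬ P i} => Bp i.1 i.1) := by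
          ext i j
          by_cases hij : i = j
          · subst hij; simp [Matrix.toSquareBlockProp]
          · rw [Matrix.diagonal_apply_ne _ hij]
            exact hBpoff i.1 j.1 (fun h => hij (Subtype.ext h)) (not_lt.mp i.2)
        rw [this, Matrix.det_diagonal]
        symm
        apply Finset.prod_subtype
        intro x
        simp [P]
    · intro i hi j hj
      refine hBpoff i j ?_ (not_lt.mp hi)
      rintro rfl
      exact hi hj
  have hN0 : ((N.det : ℤ) : ZMod p) ≠ 0 := by
    intro h
    rw [h, zero_mul, hBpdet] at hblock
    exact hd0 hblock
  -- diagonal entries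
  have hui : ∀ i : Fin (2 * g), 2 * g - m ≤ (i : ℕ) →
      legendreSym p (s i * (t i / (p : ℤ) ^ k i)) = legendreSym p (B i i) := by
    intro i hi
    obtain ⟨hgcd, htpos, hinv⟩ := hst i hi
    have hMu : IsUnit (M.map (Int.cast : ℤ → ℚ)).det := by
      have : (M.map (Int.cast : ℤ → ℚ)).det = ((M.det : ℤ) : ℚ) := by
        change (M.map (Int.castRingHom ℚ)).det = _
        rw [← RingHom.mapMatrix_apply, ← RingHom.map_det]; rfl
      rw [this, isUnit_iff_ne_zero]
      have : M.det ≠ 0 := by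
        rintro h; rw [h] at hodd; exact absurd hodd (by decide)
      exact_mod_cast this
    have h1 : B.adjugate * M = B.det • Matrix.diagonal (fun j => (p : ℤ) ^ k j) := by
      conv_lhs => rw [hMA]
      rw [← Matrix.mul_assoc, Matrix.adjugate_mul, Matrix.smul_mul, Matrix.one_mul]
    have h2 : B.adjugate.map (Int.cast : ℤ → ℚ) =
        (B.det • Matrix.diagonal (fun j => (p : ℤ) ^ k j)).map (Int.cast : ℤ → ℚ) *
          (M.map (Int.cast : ℤ → ℚ))⁻¹ := by
      rw [← h1]
      have : (B.adjugate * M).map (Int.cast : ℤ → ℚ) =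
          B.adjugate.map (Int.cast : ℤ → ℚ) * M.map (Int.cast : ℤ → ℚ) :=
        Matrix.map_mul (f := Int.castRingHom ℚ)
      rw [this, Matrix.mul_nonsing_inv_cancel_right _ _ hMu]
    have h3 := congrFun (congrFun h2 i) i
    have hdg : (B.det • Matrix.diagonal (fun j => (p : ℤ) ^ k j)).map (Int.cast : ℤ → ℚ) =
        Matrix.diagonal (fun j => ((B.det * (p : ℤ) ^ k j : ℤ) : ℚ)) := by
      ext a b
      by_cases hab : a = b
      · subst hab
        rw [Matrix.map_apply, Matrix.smul_apply, Matrix.diagonal_apply_eq,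
          Matrix.diagonal_apply_eq, smul_eq_mul]
      · rw [Matrix.map_apply, Matrix.smul_apply, Matrix.diagonal_apply_ne _ hab,
          Matrix.diagonal_apply_ne _ hab, smul_zero, Int.cast_zero]
    rw [hdg, Matrix.diagonal_mul, hinv, Matrix.map_apply] at h3
    have ht0 : (t i : ℚ) ≠ 0 := by exact_mod_cast htpos.ne'
    have h4 : t i * B.adjugate i i = B.det * (p : ℤ) ^ k i * s i := by
      field_simp at h3
      have h5 : ((t i * B.adjugate i i : ℤ) : ℚ) = ((B.det * (p : ℤ) ^ k i * s i : ℤ) : ℚ) := by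
        push_cast at h3 ⊢
        linarith
      exact_mod_cast h5
    -- mod p relation
    have h5 : Bp i i * ((B.adjugate i i : ℤ) : ZMod p) = ((B.det : ℤ) : ZMod p) := by
      have h6 : ((B * B.adjugate) i i : ℤ) = B.det := by
        rw [Matrix.mul_adjugate]; simp
      rw [← h6, Matrix.mul_apply]
      push_cast
      rw [Finset.sum_eq_single i]
      · simp [hBp]
      · intro b _ hb
        have := hBpoff i b (Ne.symm hb) hi
        simp only [hBp, Matrix.map_apply, eq_intCast] at this
        rw [this, zero_mul]
      · simp
    have hadj0 : ((B.adjugate i i : ℤ) : ZMod p) ≠ 0 := by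
      intro h; rw [h, mul_zero] at h5; exact hd0 h5.symm
    have hcop : IsCoprime ((p : ℤ) ^ k i) (B.adjugate i i) := by
      apply IsCoprime.pow_left
      rw [Prime.coprime_iff_not_dvd (Nat.prime_iff_prime_int.mp hpp),
        ← ZMod.intCast_zmod_eq_zero_iff_dvd]
      exact hadj0
    have hpt : (p : ℤ) ^ k i ∣ t i := by
      apply hcop.dvd_of_dvd_mul_right
      rw [h4]
      exact ⟨B.det * s i, by ring⟩
    obtain ⟨t', ht'⟩ := hpt
    have hpk : (p : ℤ) ^ k i ≠ 0 := pow_ne_zero _ hpZ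
    rw [ht', Int.mul_ediv_cancel_left _ hpk]
    have h7 : t' * B.adjugate i i = B.det * s i := by
      apply mul_left_cancel₀ hpk
      rw [ht'] at h4
      linear_combination h4
    have h8 : ((t' : ℤ) : ZMod p) = Bp i i * ((s i : ℤ) : ZMod p) := by
      apply mul_right_cancel₀ hadj0
      have : ((t' * B.adjugate i i : ℤ) : ZMod p) = ((B.det * s i : ℤ) : ZMod p) := by rw [h7]
      rw [Int.cast_mul, Int.cast_mul] at this
      rw [this, ← h5]; ring
    have hs0 : ((s i : ℤ) : ZMod p) ≠ 0 := by
      rw [Ne, ZMod.intCast_zmod_eq_zero_iff_dvd]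
      intro hps
      have hpt : (p : ℤ) ∣ t i := by
        rw [ht']
        exact (dvd_pow_self _ (by have := hk1 i hi; omega)).mul_right _
      have := Int.dvd_coe_gcd hps hpt
      rw [hgcd] at this
      have h9 : p ∣ 1 := by exact_mod_cast this
      exact hpp.one_lt.ne' (Nat.dvd_one.mp h9)
    have h10 : legendreSym p t' = legendreSym p (B i i) * legendreSym p (s i) := by
      rw [← legendreSym.mul]
      unfold legendreSym
      congr 1
      rw [h8]; simp [hBp]
    rw [legendreSym.mul, h10]
    have := legendreSym.sq_one p hs0
    linear_combination legendreSym p (B i i) * this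
  refine ⟨?_, ?_, ?_⟩
  · rw [← ZMod.intCast_zmod_eq_zero_iff_dvd]; exact hN0
  · have h1 : M.map (Int.cast : ℤ → ZMod p) =
        Bp * Matrix.diagonal (fun j => (p : ZMod p) ^ k j) := by
      ext i j
      rw [Matrix.mul_diagonal, Matrix.map_apply, hA i j]
      simp [hBp, hB, mul_comm]
    have h2 : (M.map (Int.cast : ℤ → ZMod p)).rank = 2 * g - m := by
      rw [h1, Matrix.rank_mul_eq_right_of_isUnit_det _ _
        (by rw [hBpdet]; exact isUnit_iff_ne_zero.mpr hd0), Matrix.rank_diagonal]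
      have h3 : ∀ i : Fin (2 * g), (p : ZMod p) ^ k i ≠ 0 ↔ (i : ℕ) < 2 * g - m := by
        intro i
        constructor
        · intro h
          by_contra h'
          have := hk1 i (not_lt.mp h')
          apply h
          rw [CharP.cast_eq_zero, zero_pow (by omega)]
        · intro h
          rw [hk0 i h]; simp
      rw [← Fintype.card_fin (2 * g - m)]
      exact Fintype.card_congr
          { toFun := fun i => ⟨i.1, (h3 i.1).mp i.2⟩
            invFun := fun i => ⟨Fin.castLE (Nat.sub_le (2 * g) m) i, (h3 _).mpr i.2⟩
            left_inv := fun i => rfl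
            right_inv := fun i => rfl }
    have h3 := LinearMap.finrank_range_add_finrank_ker
      (Matrix.mulVecLin (M.map (Int.cast : ℤ → ZMod p)))
    unfold Matrix.rank at h2
    rw [h2, Module.finrank_fintype_fun_eq_card, Fintype.card_fin] at h3
    unfold kerDimModP
    omega
  · have hpodd : p % 2 = 1 := hpp.eq_two_or_odd.resolve_left hp2
    have hm1 : legendreSym p (-1) = (-1) ^ ((p - 1) / 2) := by
      rw [legendreSym.at_neg_one hp2, ZMod.χ₄_eq_neg_one_pow hpodd]
      congr 1; omega
    have hpow : ∀ n : ℕ, legendreSym p ((-1) ^ n) = (-1) ^ ((p - 1) / 2 * n) := by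
      intro n
      induction n with
      | zero => simp
      | succ n ih => rw [pow_succ, legendreSym.mul, ih, hm1, mul_add, pow_add, mul_one]
    have hLd : legendreSym p B.det = legendreSym p N.det *
        ∏ i ∈ Finset.univ.filter (fun i : Fin (2 * g) => 2 * g - m ≤ (i : ℕ)),
          legendreSym p (s i * (t i / (p : ℤ) ^ k i)) := by
      rw [Finset.prod_congr rfl (fun i hi => hui i (by simpa using hi))]
      have hBi : ∀ i, legendreSym p (B i i) = quadraticChar (ZMod p) (Bp i i) := by
        intro i; simp [legendreSym, hBp]
      simp only [hBi]
      rw [← map_prod]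
      unfold legendreSym
      rw [← map_mul, ← hblock, hBpdet]
    set Q := ∏ i ∈ Finset.univ.filter (fun i : Fin (2 * g) => 2 * g - m ≤ (i : ℕ)),
          legendreSym p (s i * (t i / (p : ℤ) ^ k i)) with hQ
    have hQ2 : Q ^ 2 = 1 := by
      have h1 := legendreSym.sq_one p hd0
      have h2 := legendreSym.sq_one p hN0
      rw [hLd, mul_pow, h2, one_mul] at h1
      exact h1
    have hoddq : Odd q := by
      have : Odd M.det.natAbs := Int.natAbs_odd.mpr hodd
      rw [hdet] at this
      exact (Nat.odd_mul.mp this).2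
    have hpar : Even (e + (p - 1) / 2 * α + (q - 1) / 2) ↔ Even g := by
      apply z4_parity
      rw [← int_det_mod4 g M hsymm hdiag hodd, hdetM, he]
      push_cast
      rw [z4_odd q hoddq, z4_odd p (Nat.odd_iff.mpr hpodd), ← pow_mul, pow_add, pow_add]
      ring
    have hsg := sign_parity ((p - 1) / 2) e g m α ((q - 1) / 2) hpar
    rw [he, legendreSym.mul, hpow] at hLd
    rw [legendreSym.mul, hpow, ← hsg, pow_add]
    linear_combination (-(-1 : ℤ) ^ ((p - 1) / 2 * (m + g)) * legendreSym p N.det) * hQ2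
      - (-1 : ℤ) ^ ((p - 1) / 2 * (m + g)) * Q * hLd
end
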